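/- (Cylinder flip lemma) Let H1 and H2 be signed graphs all of whose edges are positive, with distinguished vertices s1, s2, t1, t2 ∈ V(H1) and s1', s2', t1', t2' ∈ V(H2). Let Ω be the signed graph obtained from the disjoint union of H1 and H2 by adding positive edges {s1,s1'} and {s2,s2'} and negative edges {t1,t1'} and {t2,t2'}; let Ω' be obtained instead by adding positive edges {s1,s2'} and {s2,s1'} and negative edges {t1,t2'} and {t2,t1'}. Then under the natural bijection of edge sets, the frame matroids satisfy M(Ω) = M(Ω'). -/

import Mathlib

open Set

/-- A signed graph: each edge has an unordered pair of endpoints, and `neg` is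
the set of negative edges. -/
structure SGraph (V E : Type*) where
  ends : E → Sym2 V
  neg : Set E

namespace SGraph

variable {V E : Type*}

/-- A cycle in a signed graph: `n ≥ 1` distinct vertices and `n` distinct edges
arranged cyclically. -/
structure Cyc (G : SGraph V E) where
  n : ℕ
  hn : 0 < n
  vtx : ZMod n → V
  edge : ZMod n → E
  vtx_inj : Function.Injective vtx
  edge_inj : Function.Injective edge
  incid : ∀ i, G.ends (edge i) = s(vtx i, vtx (i + 1))

def Cyc.edges {G : SGraph V E} (C : Cyc G) : Set E := Set.range C.edge

def Cyc.vertices {G : SGraph V E} (C : Cyc G) : Set V := Set.range C.vtx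

/-- A cycle is positive with respect to a set `N` of negative edges if it
contains an even number of edges from `N`. -/
def Cyc.PositiveIn {G : SGraph V E} (C : Cyc G) (N : Set E) : Prop :=
  Even (C.edges ∩ N).ncard

def Cyc.Positive {G : SGraph V E} (C : Cyc G) : Prop := C.PositiveIn G.neg

def Cyc.Negative {G : SGraph V E} (C : Cyc G) : Prop := ¬ C.Positive

/-- A path joining the vertex set `S` to the vertex set `T`, internally
disjoint from `S ∪ T`. -/
structure ConnPath (G : SGraph V E) (S T : Set V) where
  n : ℕ
  vtx : Fin (n + 1) → V
  edge : Fin n → E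
  vtx_inj : Function.Injective vtx
  edge_inj : Function.Injective edge
  incid : ∀ i : Fin n, G.ends (edge i) = s(vtx i.castSucc, vtx i.succ)
  first_mem : vtx 0 ∈ S
  last_mem : vtx (Fin.last n) ∈ T
  internal : ∀ i : Fin (n + 1), i ≠ 0 → i ≠ Fin.last n → vtx i ∉ S ∪ T

def ConnPath.edges {G : SGraph V E} {S T : Set V} (P : ConnPath G S T) : Set E :=
  Set.range P.edge

/-- The circuits of the frame matroid of a signed graph: positive cycles, pairs
of negative cycles meeting in exactly one vertex, and pairs of vertex-disjoint
negative cycles together with a minimal connecting path. -/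
inductive FrameCircuit (G : SGraph V E) : Set E → Prop
  | pos (C : Cyc G) (h : C.Positive) : FrameCircuit G C.edges
  | tight (C₁ C₂ : Cyc G) (h₁ : C₁.Negative) (h₂ : C₂.Negative)
      (hne : C₁.edges ≠ C₂.edges) (v : V)
      (hmeet : C₁.vertices ∩ C₂.vertices = {v}) :
      FrameCircuit G (C₁.edges ∪ C₂.edges)
  | loose (C₁ C₂ : Cyc G) (h₁ : C₁.Negative) (h₂ : C₂.Negative)
      (hV : Disjoint C₁.vertices C₂.vertices)
      (P : ConnPath G C₁.vertices C₂.vertices) :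
      FrameCircuit G (C₁.edges ∪ C₂.edges ∪ P.edges)

end SGraph

/-- `C` is a circuit of the matroid `M`: a minimal dependent set. -/
def Matroid.IsCircuit' {E : Type*} (M : Matroid E) (C : Set E) : Prop :=
  C ⊆ M.E ∧ ¬ M.Indep C ∧ ∀ D ⊂ C, M.Indep D

/-- `M` is the frame matroid of the signed graph `G`: its ground set is all
edges and its circuits are exactly the frame circuits of `G`. -/
def SGraph.IsFrameMatroid {V E : Type*} (G : SGraph V E) (M : Matroid E) : Prop :=
  M.E = Set.univ ∧ ∀ C : Set E, M.IsCircuit' C ↔ G.FrameCircuit C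

open SGraph in
/-- The signed graph obtained from the disjoint union of `H₁` and `H₂` by
adding four connecting edges, the `i`-th joining `(c i).1 ∈ V₁` to
`(c i).2 ∈ V₂`; the last two connecting edges (indices 2 and 3) are negative
and all other edges of the glued graph keep their signs. -/
def glueWith {V₁ V₂ E₁ E₂ : Type*} (H₁ : SGraph V₁ E₁) (H₂ : SGraph V₂ E₂)
    (c : Fin 4 → V₁ × V₂) : SGraph (V₁ ⊕ V₂) (E₁ ⊕ E₂ ⊕ Fin 4) where
  ends
    | Sum.inl e => (H₁.ends e).map Sum.inl
    | Sum.inr (Sum.inl e) => (H₂.ends e).map Sum.inr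
    | Sum.inr (Sum.inr i) => s(Sum.inl (c i).1, Sum.inr (c i).2)
  neg := (Sum.inl '' H₁.neg) ∪ ((Sum.inr ∘ Sum.inl) '' H₂.neg) ∪
    {Sum.inr (Sum.inr 2), Sum.inr (Sum.inr 3)}

namespace SGraph

variable {V E : Type*}

open Classical in
/-- The sign of an edge, as a rational number. -/
noncomputable def sg (G : SGraph V E) (e : E) : ℚ := if e ∈ G.neg then -1 else 1

/-- `r` is a signed incidence representation of `G`. -/
def IsRep (G : SGraph V E) (r : E → V →₀ ℚ) : Prop :=
  ∀ e a b, G.ends e = s(a, b) →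
    ∃ ε : ℚ, ε ≠ 0 ∧ r e = ε • (Finsupp.single a (1 : ℚ) - G.sg e • Finsupp.single b (1 : ℚ))

/-- Linear dependency. -/
def Ker (r : E → V →₀ ℚ) (l : E →₀ ℚ) : Prop := Finsupp.linearCombination ℚ r l = 0

/-- Sets of the first `n` values. -/
def ES {α : Type*} (n : ℕ) (e : ℕ → α) : Set α := {x | ∃ i < n, e i = x}

structure IsCy (G : SGraph V E) (n : ℕ) (v : ℕ → V) (e : ℕ → E) : Prop where
  pos : 0 < n
  inc : ∀ i < n, G.ends (e i) = s(v i, v (i + 1))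
  cl : v n = v 0
  vinj : ∀ i < n, ∀ j < n, v i = v j → i = j
  einj : ∀ i < n, ∀ j < n, e i = e j → i = j

structure IsPa (G : SGraph V E) (n : ℕ) (v : ℕ → V) (e : ℕ → E) : Prop where
  inc : ∀ i < n, G.ends (e i) = s(v i, v (i + 1))
  vinj : ∀ i ≤ n, ∀ j ≤ n, v i = v j → i = j

lemma sg_sq (G : SGraph V E) (e : E) : G.sg e * G.sg e = 1 := by
  unfold sg; split_ifs <;> norm_num

lemma sg_ne (G : SGraph V E) (e : E) : G.sg e ≠ 0 := by
  unfold sg; split_ifs <;> norm_num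

/-- The sign of a sequence of edges. -/
noncomputable def sp (G : SGraph V E) (e : ℕ → E) (n : ℕ) : ℚ := ∏ i ∈ Finset.range n, G.sg (e i)

lemma sp_succ (G : SGraph V E) (e : ℕ → E) (n : ℕ) : G.sp e (n + 1) = G.sp e n * G.sg (e n) := by
  unfold sp; rw [Finset.prod_range_succ]

lemma sp_zero (G : SGraph V E) (e : ℕ → E) : G.sp e 0 = 1 := by simp [sp]

lemma sp_sq (G : SGraph V E) (e : ℕ → E) (n : ℕ) : G.sp e n * G.sp e n = 1 := by
  induction n with
  | zero => simp [sp]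
  | succ n ih =>
    rw [sp_succ]
    have := sg_sq G (e n)
    calc _ = (G.sp e n * G.sp e n) * (G.sg (e n) * G.sg (e n)) := by ring
      _ = 1 := by rw [ih, this]; norm_num

lemma sp_ne (G : SGraph V E) (e : ℕ → E) (n : ℕ) : G.sp e n ≠ 0 := by
  intro h; have := sp_sq G e n; rw [h] at this; norm_num at this

lemma sp_eq (G : SGraph V E) (e : ℕ → E) (n : ℕ) (h : ∀ i < n, ∀ j < n, e i = e j → i = j) :
    G.sp e n = (-1) ^ (ES n e ∩ G.neg).ncard := by
  classical
  have h1 : ES n e ∩ G.neg = (((Finset.range n).filter (fun i => e i ∈ G.neg)).image e : Finset E) := by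
    ext x
    simp only [ES, Set.mem_inter_iff, Set.mem_ofPred_eq, Finset.coe_image, Finset.coe_filter,
      Finset.mem_range, Set.mem_image]
    constructor
    · rintro ⟨⟨i, hi, rfl⟩, hx⟩; exact ⟨i, ⟨hi, hx⟩, rfl⟩
    · rintro ⟨i, ⟨hi, hx⟩, rfl⟩; exact ⟨⟨i, hi, rfl⟩, hx⟩
  rw [h1, Set.ncard_coe_finset, Finset.card_image_of_injOn]
  · unfold sp sg
    rw [Finset.prod_ite]
    simp
  · intro i hi j hj hij
    simp at hi hj
    exact h i hi.1 j hj.1 hij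

lemma sp_one_iff (G : SGraph V E) (e : ℕ → E) (n : ℕ) (h : ∀ i < n, ∀ j < n, e i = e j → i = j) :
    Even (ES n e ∩ G.neg).ncard → G.sp e n = 1 := by
  intro h'; rw [sp_eq G e n h, h'.neg_one_pow]

lemma sp_neg_iff (G : SGraph V E) (e : ℕ → E) (n : ℕ) (h : ∀ i < n, ∀ j < n, e i = e j → i = j) :
    ¬ Even (ES n e ∩ G.neg).ncard → G.sp e n = -1 := by
  intro h'; rw [sp_eq G e n h, (Nat.not_even_iff_odd.1 h').neg_one_pow]

/-! ### Conversions -/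

lemma Cyc.toNat {G : SGraph V E} (C : Cyc G) (b : V) (hb : b ∈ C.vertices) :
    ∃ n v e, IsCy G n v e ∧ v 0 = b ∧ ES n e = C.edges ∧ ES n v = C.vertices := by
  obtain ⟨k, rfl⟩ := hb
  have : NeZero C.n := ⟨C.hn.ne'⟩
  have key : ∀ i < C.n, ∀ j < C.n, (k + (i : ZMod C.n)) = k + (j : ZMod C.n) → i = j := by
    intro i hi j hj h
    have h := add_left_cancel h
    rw [ZMod.natCast_eq_natCast_iff'] at h
    rwa [Nat.mod_eq_of_lt hi, Nat.mod_eq_of_lt hj] at h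
  have sur : ∀ x : ZMod C.n, ∃ i < C.n, k + (i : ZMod C.n) = x := by
    intro x
    exact ⟨(x - k).val, ZMod.val_lt _, by simp⟩
  refine ⟨C.n, fun i => C.vtx (k + i), fun i => C.edge (k + i), ⟨C.hn, ?_, ?_, ?_, ?_⟩, ?_, ?_, ?_⟩
  · intro i hi
    rw [C.incid]; push_cast; rw [add_assoc]
  · simp
  · intro i hi j hj h; exact key i hi j hj (C.vtx_inj h)
  · intro i hi j hj h; exact key i hi j hj (C.edge_inj h)
  · simp
  · ext x; constructor
    · rintro ⟨i, hi, rfl⟩; exact ⟨_, rfl⟩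
    · rintro ⟨i, rfl⟩; obtain ⟨j, hj, rfl⟩ := sur i; exact ⟨j, hj, rfl⟩
  · ext x; constructor
    · rintro ⟨i, hi, rfl⟩; exact ⟨_, rfl⟩
    · rintro ⟨i, rfl⟩; obtain ⟨j, hj, rfl⟩ := sur i; exact ⟨j, hj, rfl⟩

lemma IsCy.toCyc {G : SGraph V E} {n : ℕ} {v : ℕ → V} {e : ℕ → E} (h : IsCy G n v e) :
    ∃ C : Cyc G, C.edges = ES n e ∧ C.vertices = ES n v := by
  have : NeZero n := ⟨h.pos.ne'⟩
  refine ⟨⟨n, h.pos, fun i => v i.val, fun i => e i.val, ?_, ?_, ?_⟩, ?_, ?_⟩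
  · intro i j hij
    exact ZMod.val_injective n (h.vinj _ (ZMod.val_lt _) _ (ZMod.val_lt _) hij)
  · intro i j hij
    exact ZMod.val_injective n (h.einj _ (ZMod.val_lt _) _ (ZMod.val_lt _) hij)
  · intro i
    rw [h.inc _ (ZMod.val_lt _)]
    have hi := ZMod.val_lt i
    rcases Nat.lt_or_ge (i.val + 1) n with h1 | h1
    · have : (i + 1).val = i.val + 1 := by
        have h2 : i + 1 = ((i.val + 1 : ℕ) : ZMod n) := by simp
        rw [h2, ZMod.val_natCast, Nat.mod_eq_of_lt h1]
      rw [this]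
    · have h3 : i.val + 1 = n := by omega
      have : (i + 1).val = 0 := by
        have h2 : i + 1 = ((i.val + 1 : ℕ) : ZMod n) := by simp
        rw [h2, ZMod.val_natCast, h3, Nat.mod_self]
      rw [this, h3, h.cl]
  · ext x; constructor
    · rintro ⟨i, rfl⟩; exact ⟨_, ZMod.val_lt i, rfl⟩
    · rintro ⟨i, hi, rfl⟩
      exact ⟨(i : ZMod n), by simp [ZMod.val_natCast, Nat.mod_eq_of_lt hi]⟩
  · ext x; constructor
    · rintro ⟨i, rfl⟩; exact ⟨_, ZMod.val_lt i, rfl⟩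
    · rintro ⟨i, hi, rfl⟩
      exact ⟨(i : ZMod n), by simp [ZMod.val_natCast, Nat.mod_eq_of_lt hi]⟩

lemma ConnPath.toNat {G : SGraph V E} {S T : Set V} (P : ConnPath G S T) (e0 : E) :
    ∃ n v e, IsPa G n v e ∧ v 0 ∈ S ∧ v n ∈ T ∧ (∀ i, 0 < i → i < n → v i ∉ S ∧ v i ∉ T) ∧
      ES n e = P.edges := by
  refine ⟨P.n, fun i => P.vtx ⟨min i P.n, by omega⟩,
    fun i => if h : i < P.n then P.edge ⟨i, h⟩ else e0, ⟨?_, ?_⟩, ?_, ?_, ?_, ?_⟩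
  · intro i hi
    simp only [hi, dite_true]
    rw [P.incid]
    congr 3
    · apply Fin.ext; simp; omega
    · apply Fin.ext; simp; omega
  · intro i hi j hj h
    have := P.vtx_inj h
    simp at this; omega
  · convert P.first_mem using 2
    apply Fin.ext; simp
  · convert P.last_mem using 2
    apply Fin.ext; simp
  · intro i hi hi'
    have := P.internal ⟨min i P.n, by omega⟩ (by intro h; simp [Fin.ext_iff] at h; omega)
      (by intro h; simp [Fin.ext_iff] at h; omega)
    simpa using this
  · ext x; constructor
    · rintro ⟨i, hi, rfl⟩; simp only [hi, dite_true]; exact ⟨_, rfl⟩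
    · rintro ⟨i, rfl⟩; exact ⟨i, i.2, by simp⟩

lemma IsPa.einj {G : SGraph V E} {n : ℕ} {v : ℕ → V} {e : ℕ → E} (h : IsPa G n v e) :
    ∀ i < n, ∀ j < n, e i = e j → i = j := by
  intro i hi j hj hij
  have h1 := h.inc i hi
  rw [hij, h.inc j hj, Sym2.eq_iff] at h1
  rcases h1 with ⟨a, -⟩ | ⟨a, b⟩
  · exact (h.vinj _ (by omega) _ (by omega) a).symm
  · have := h.vinj _ (by omega) _ (by omega) a
    have := h.vinj _ (by omega) _ (by omega) b
    omega

lemma IsPa.toConn {G : SGraph V E} {n : ℕ} {v : ℕ → V} {e : ℕ → E} (h : IsPa G n v e)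
    {S T : Set V} (h0 : v 0 ∈ S) (h1 : v n ∈ T)
    (hi : ∀ i, 0 < i → i < n → v i ∉ S ∧ v i ∉ T) :
    ∃ P : ConnPath G S T, P.edges = ES n e := by
  refine ⟨⟨n, fun i => v i, fun i => e i, ?_, ?_, ?_, by simpa using h0, by simpa using h1, ?_⟩, ?_⟩
  · intro i j hij
    exact Fin.ext (h.vinj _ (by omega) _ (by omega) hij)
  · intro i j hij
    exact Fin.ext (h.einj _ (by omega) _ (by omega) hij)
  · intro i; simpa using h.inc i i.2
  · intro i h0 h1
    have a := hi i (by rcases Nat.eq_zero_or_pos i.val with h | h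
                       · exact absurd (Fin.ext h) h0
                       · exact h)
      (by
        have : i.val ≠ n := fun h => h1 (Fin.ext (by simpa using h))
        omega)
    simpa using a
  · ext x; constructor
    · rintro ⟨i, rfl⟩; exact ⟨i, i.2, rfl⟩
    · rintro ⟨i, hi, rfl⟩; exact ⟨⟨i, hi⟩, rfl⟩

end SGraph
namespace SGraph

variable {V E : Type*}

/-! ### Linear algebra -/

lemma walk_comb {G : SGraph V E} {r : E → V →₀ ℚ} (hr : G.IsRep r) (v : ℕ → V) (e : ℕ → E) (n : ℕ)
    (inc : ∀ i < n, G.ends (e i) = s(v i, v (i + 1))) :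
    ∃ l : E →₀ ℚ, (l.support : Set E) ⊆ ES n e ∧
      Finsupp.linearCombination ℚ r l =
        Finsupp.single (v 0) (1 : ℚ) - G.sp e n • Finsupp.single (v n) (1 : ℚ) ∧
      ((∀ i, 0 < i → i < n → e i ≠ e 0) → 0 < n → l (e 0) ≠ 0) := by
  classical
  induction n with
  | zero => exact ⟨0, by simp, by simp [sp_zero], by simp⟩
  | succ n ih =>
    obtain ⟨l, h1, h2, h3⟩ := ih (fun i hi => inc i (by omega))
    obtain ⟨ε, hε, hre⟩ := hr _ _ _ (inc n (by omega))
    refine ⟨l + Finsupp.single (e n) (G.sp e n / ε), ?_, ?_, ?_⟩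
    · intro x hx
      have := Finsupp.support_add hx
      rw [Finset.mem_union] at this
      rcases this with h | h
      · obtain ⟨i, hi, rfl⟩ := h1 h
        exact ⟨i, by omega, rfl⟩
      · have := Finsupp.support_single_subset h
        simp at this
        exact ⟨n, by omega, this.symm⟩
    · rw [map_add, h2, Finsupp.linearCombination_single, hre, sp_succ, smul_smul,
        div_mul_cancel₀ _ hε, smul_sub, smul_smul]
      abel
    · intro hd _
      rcases Nat.eq_zero_or_pos n with rfl | hn
      · have : l (e 0) = 0 := by
          by_contra hne
          obtain ⟨i, hi, _⟩ := h1 (Finsupp.mem_support_iff.2 hne)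
          omega
        simp [this, sp_zero, hε]
      · rw [Finsupp.add_apply, Finsupp.single_apply, if_neg (hd n hn (by omega)), add_zero]
        exact h3 (fun i hi hi' => hd i hi (by omega)) hn

lemma dual {G : SGraph V E} {r : E → V →₀ ℚ} (hr : G.IsRep r) {l : E →₀ ℚ} (hl : Ker r l)
    (φ : V → ℚ) (f : E) (a b : V) (hf : G.ends f = s(a, b)) (hφ : φ a - G.sg f * φ b ≠ 0)
    (h : ∀ g, g ≠ f → l g ≠ 0 → ∀ a b, G.ends g = s(a, b) → φ a - G.sg g * φ b = 0) : l f = 0 := by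
  have key : ∀ g a b, G.ends g = s(a, b) → ∃ ε : ℚ, ε ≠ 0 ∧
      Finsupp.linearCombination ℚ φ (r g) = ε * (φ a - G.sg g * φ b) := by
    intro g a b hg
    obtain ⟨ε, hε, h⟩ := hr g a b hg
    refine ⟨ε, hε, ?_⟩
    rw [h]
    simp [Finsupp.linearCombination_single]
  have h0 : Finsupp.linearCombination ℚ φ (Finsupp.linearCombination ℚ r l) = 0 := by
    rw [show Finsupp.linearCombination ℚ r l = 0 from hl, map_zero]
  have hL : Finsupp.linearCombination ℚ r l = ∑ g ∈ l.support, l g • r g := by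
    rw [Finsupp.linearCombination_apply, Finsupp.sum]
  rw [hL, map_sum] at h0
  by_contra hne
  rw [Finset.sum_eq_single_of_mem f (Finsupp.mem_support_iff.2 hne)] at h0
  · obtain ⟨ε, hε, h1⟩ := key f a b hf
    rw [map_smul, h1, smul_eq_mul] at h0
    exact mul_ne_zero hne (mul_ne_zero hε hφ) h0
  · intro g hg hgf
    obtain ⟨⟨c, d⟩, hcd⟩ := Quot.exists_rep (G.ends g)
    obtain ⟨ε, hε, h1⟩ := key g c d hcd.symm
    rw [map_smul, h1, h g hgf (Finsupp.mem_support_iff.1 hg) c d hcd.symm]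
    simp

lemma leaf {G : SGraph V E} {r : E → V →₀ ℚ} (hr : G.IsRep r) {l : E →₀ ℚ} (hl : Ker r l)
    (f : E) (a b : V) (hf : G.ends f = s(a, b)) (hab : a ≠ b)
    (h : ∀ g, g ≠ f → l g ≠ 0 → a ∉ G.ends g) : l f = 0 := by
  classical
  refine dual hr hl (fun x => if x = a then 1 else 0) f a b hf (by simp [hab.symm]) ?_
  intro g hg hlg c d hcd
  have := h g hg hlg
  rw [hcd, Sym2.mem_iff, not_or] at this
  simp [Ne.symm this.1, Ne.symm this.2]

lemma exists_ext (n : ℕ) (v : ℕ → V) (x : ℕ → ℚ) (h : ∀ i < n, ∀ j < n, v i = v j → i = j) :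
    ∃ φ : V → ℚ, (∀ i < n, φ (v i) = x i) ∧ ∀ y, y ∉ ES n v → φ y = 0 := by
  classical
  refine ⟨fun y => if hy : ∃ i < n, v i = y then x hy.choose else 0, ?_, ?_⟩
  · intro i hi
    have hy : ∃ j < n, v j = v i := ⟨i, hi, rfl⟩
    simp only [dif_pos hy]
    rw [h _ hy.choose_spec.1 _ hi hy.choose_spec.2]
  · intro y hy
    exact dif_neg hy

lemma pot_symm (G : SGraph V E) {g : E} {φ : V → ℚ} {a b c d : V} (h1 : G.ends g = s(a, b))
    (h2 : G.ends g = s(c, d)) (h : φ a - G.sg g * φ b = 0) : φ c - G.sg g * φ d = 0 := by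
  rw [h1, Sym2.eq_iff] at h2
  rcases h2 with ⟨rfl, rfl⟩ | ⟨rfl, rfl⟩
  · exact h
  · have := sg_sq G g
    linear_combination (-G.sg g) * h - φ b * this

/-- A dependency vanishes on an isolated negative cycle. -/
lemma neg_cycle {G : SGraph V E} {r : E → V →₀ ℚ} (hr : G.IsRep r) {l : E →₀ ℚ} (hl : Ker r l)
    {n : ℕ} {v : ℕ → V} {e : ℕ → E} (hC : IsCy G n v e) (hs : G.sp e n = -1)
    (h : ∀ g, l g ≠ 0 → ∀ y ∈ ES n v, y ∈ G.ends g → g ∈ ES n e) :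
    ∀ j < n, l (e j) = 0 := by
  intro j hj
  obtain ⟨φ, h1, h2⟩ := exists_ext n v (fun i => if i ≤ j then G.sp e i else - G.sp e i) hC.vinj
  have hv : ∀ i < n, φ (v (i + 1)) = if i + 1 ≤ j then G.sp e (i + 1) else - G.sp e (i + 1) := by
    intro i hi
    rcases Nat.lt_or_ge (i + 1) n with h' | h'
    · exact h1 _ h'
    · have : i + 1 = n := by omega
      rw [this, hC.cl, h1 0 hC.pos, hs, if_pos (Nat.zero_le j), if_neg (by omega)]
      simp [sp_zero]
  have hsq := fun i => sg_sq G (e i)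
  refine dual hr hl φ (e j) _ _ (hC.inc j hj) ?_ ?_
  · rw [h1 j hj, hv j hj, if_pos le_rfl, if_neg (by omega), sp_succ]
    have : G.sp e j - G.sg (e j) * -(G.sp e j * G.sg (e j)) = 2 * G.sp e j := by
      linear_combination G.sp e j * hsq j
    rw [this]
    exact mul_ne_zero two_ne_zero (sp_ne _ _ _)
  · intro g hg hlg a b hab
    by_cases hge : g ∈ ES n e
    · obtain ⟨i, hi, rfl⟩ := hge
      refine pot_symm G (hC.inc i hi) hab ?_
      have hij : i ≠ j := fun h => hg (by rw [h])
      rw [h1 i hi, hv i hi, sp_succ]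
      by_cases h3 : i ≤ j
      · rw [if_pos h3, if_pos (by omega)]
        linear_combination - G.sp e i * hsq i
      · rw [if_neg h3, if_neg (by omega)]
        linear_combination G.sp e i * hsq i
    · have ha : a ∉ ES n v := fun hy => hge (h g hlg a hy (by rw [hab]; simp))
      have hb : b ∉ ES n v := fun hy => hge (h g hlg b hy (by rw [hab]; simp))
      rw [h2 a ha, h2 b hb]; simp

/-- Propagation along a chain of degree-two vertices. -/
lemma chain {G : SGraph V E} {r : E → V →₀ ℚ} (hr : G.IsRep r) {l : E →₀ ℚ} (hl : Ker r l)
    {n : ℕ} {v : ℕ → V} {e : ℕ → E} (inc : ∀ i < n, G.ends (e i) = s(v i, v (i + 1)))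
    (hd : ∀ i, i + 1 < n → v (i + 1) ≠ v i ∧ v (i + 1) ≠ v (i + 2))
    (h : ∀ i, i + 1 < n → ∀ g, l g ≠ 0 → v (i + 1) ∈ G.ends g → g = e i ∨ g = e (i + 1)) :
    ∀ i < n, ∀ j < n, l (e i) = 0 → l (e j) = 0 := by
  have step : ∀ i, i + 1 < n → (l (e i) = 0 ↔ l (e (i + 1)) = 0) := by
    intro i hi
    constructor
    · intro h0
      refine leaf hr hl _ _ _ (inc (i + 1) hi) (hd i hi).2 ?_
      intro g hg hlg hmem
      rcases h i hi g hlg hmem with rfl | rfl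
      · exact hlg h0
      · exact hg rfl
    · intro h0
      refine leaf hr hl _ _ _ ((inc i (by omega)).trans Sym2.eq_swap) (hd i hi).1 ?_
      intro g hg hlg hmem
      rcases h i hi g hlg hmem with rfl | rfl
      · exact hg rfl
      · exact hlg h0
  have all : ∀ i, i < n → (l (e 0) = 0 ↔ l (e i) = 0) := by
    intro i
    induction i with
    | zero => simp
    | succ i ih => intro hi; exact (ih (by omega)).trans (step i hi)
  intro i hi j hj h0
  exact (all j hj).1 ((all i hi).2 h0)

lemma chain_cy {G : SGraph V E} {r : E → V →₀ ℚ} (hr : G.IsRep r) {l : E →₀ ℚ} (hl : Ker r l)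
    {n : ℕ} {v : ℕ → V} {e : ℕ → E} (hC : IsCy G n v e)
    (h : ∀ g, l g ≠ 0 → ∀ y ∈ ES n v, y ≠ v 0 → y ∈ G.ends g → g ∈ ES n e) :
    ∀ i < n, ∀ j < n, l (e i) = 0 → l (e j) = 0 := by
  have aux : ∀ i, 0 < i → i < n → ∀ j, j ≤ n → v i = v j → i = j := by
    intro i hi hin j hj hij
    rcases Nat.lt_or_ge j n with h' | h'
    · exact hC.vinj i hin j h' hij
    · have : j = n := by omega
      rw [this, hC.cl] at hij
      have := hC.vinj i hin 0 hC.pos hij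
      omega
  refine chain hr hl hC.inc ?_ ?_
  · intro i hi
    constructor
    · intro h; have := aux _ (by omega) hi i (by omega) h; omega
    · intro h; have := aux _ (by omega) hi (i + 2) (by omega) h; omega
  · intro i hi g hlg hm
    obtain ⟨j, hj, rfl⟩ := h g hlg (v (i + 1)) ⟨_, hi, rfl⟩
      (fun h => by have := aux _ (by omega) hi 0 (by omega) h; omega) hm
    rw [hC.inc j hj, Sym2.mem_iff] at hm
    rcases hm with hm | hm
    · have := aux _ (by omega) hi j (by omega) hm
      right; rw [this]
    · have := aux _ (by omega) hi (j + 1) (by omega) hm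
      left; rw [show i = j by omega]

lemma chain_pa {G : SGraph V E} {r : E → V →₀ ℚ} (hr : G.IsRep r) {l : E →₀ ℚ} (hl : Ker r l)
    {n : ℕ} {v : ℕ → V} {e : ℕ → E} (hC : IsPa G n v e)
    (h : ∀ g, l g ≠ 0 → ∀ i, 0 < i → i < n → v i ∈ G.ends g → g ∈ ES n e) :
    ∀ i < n, ∀ j < n, l (e i) = 0 → l (e j) = 0 := by
  refine chain hr hl hC.inc ?_ ?_
  · intro i hi
    constructor
    · intro h; have := hC.vinj _ (by omega) i (by omega) h; omega
    · intro h; have := hC.vinj _ (by omega) (i + 2) (by omega) h; omega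
  · intro i hi g hlg hm
    obtain ⟨j, hj, rfl⟩ := h g hlg (i + 1) (by omega) hi hm
    rw [hC.inc j hj, Sym2.mem_iff] at hm
    rcases hm with hm | hm
    · have := hC.vinj _ (by omega) j (by omega) hm
      right; rw [this]
    · have := hC.vinj _ (by omega) (j + 1) (by omega) hm
      left; rw [show i = j by omega]

/-- ends of edges of a cycle are vertices of the cycle -/
lemma IsCy.mem {G : SGraph V E} {n : ℕ} {v : ℕ → V} {e : ℕ → E} (hC : IsCy G n v e)
    {g : E} (hg : g ∈ ES n e) {y : V} (hy : y ∈ G.ends g) : y ∈ ES n v := by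
  obtain ⟨i, hi, rfl⟩ := hg
  rw [hC.inc i hi, Sym2.mem_iff] at hy
  rcases hy with rfl | rfl
  · exact ⟨i, hi, rfl⟩
  · rcases Nat.lt_or_ge (i + 1) n with h' | h'
    · exact ⟨_, h', rfl⟩
    · exact ⟨0, hC.pos, by rw [show i + 1 = n by omega, hC.cl]⟩

/-- A circuit in terms of dependencies. -/
def Circ (r : E → V →₀ ℚ) (C : Set E) : Prop :=
  (∃ l : E →₀ ℚ, l ≠ 0 ∧ (l.support : Set E) ⊆ C ∧ Ker r l) ∧
  ∀ l : E →₀ ℚ, l ≠ 0 → (l.support : Set E) ⊆ C → Ker r l → C ⊆ (l.support : Set E)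

end SGraph
namespace SGraph

variable {V E : Type*}

lemma IsPa.rev {G : SGraph V E} {n : ℕ} {v : ℕ → V} {e : ℕ → E} (h : IsPa G n v e) :
    IsPa G n (fun i => v (n - i)) (fun i => e (n - 1 - i)) := by
  constructor
  · intro i hi
    rw [h.inc _ (by omega), Sym2.eq_swap, show n - 1 - i + 1 = n - i by omega,
      show n - 1 - i = n - (i + 1) by omega]
  · intro i hi j hj hij
    have := h.vinj _ (by omega) _ (by omega) hij
    omega

lemma ES_rev {α : Type*} (n : ℕ) (e : ℕ → α) : ES n (fun i => e (n - 1 - i)) = ES n e := by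
  ext x; constructor
  · rintro ⟨i, hi, rfl⟩; exact ⟨n - 1 - i, by omega, rfl⟩
  · rintro ⟨i, hi, rfl⟩
    exact ⟨n - 1 - i, by omega, by simp only []; congr 1; omega⟩

lemma pos_circ {G : SGraph V E} {r : E → V →₀ ℚ} (hr : G.IsRep r) {n : ℕ} {v : ℕ → V} {e : ℕ → E}
    (hC : IsCy G n v e) (hs : G.sp e n = 1) : Circ r (ES n e) := by
  constructor
  · obtain ⟨l, h1, h2, h3⟩ := walk_comb hr v e n hC.inc
    refine ⟨l, ?_, h1, ?_⟩
    · intro h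
      refine h3 ?_ hC.pos (by simp [h])
      intro i hi hin hh
      have := hC.einj _ hin _ hC.pos hh
      omega
    · unfold Ker; rw [h2, hs, hC.cl]; simp
  · intro l hl hsup hk x hx
    obtain ⟨i, hi, rfl⟩ := hx
    rw [Finset.mem_coe, Finsupp.mem_support_iff]
    intro h0
    apply hl
    ext g
    by_contra hg
    have hg' := hsup (Finsupp.mem_support_iff.2 hg)
    obtain ⟨j, hj, rfl⟩ := hg'
    refine hg (chain_cy hr hk hC ?_ i hi j hj h0)
    intro g hg _ _ _ _
    exact hsup (Finsupp.mem_support_iff.2 hg)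

structure IsTight (G : SGraph V E) (n : ℕ) (v : ℕ → V) (e : ℕ → E) (n' : ℕ) (v' : ℕ → V)
    (e' : ℕ → E) : Prop where
  h1 : IsCy G n v e
  h2 : IsCy G n' v' e'
  s1 : G.sp e n = -1
  s2 : G.sp e' n' = -1
  b : v 0 = v' 0
  meet : ∀ y ∈ ES n v, y ∈ ES n' v' → y = v 0
  ne : ES n e ≠ ES n' e'

lemma IsTight.symm {G : SGraph V E} {n : ℕ} {v : ℕ → V} {e : ℕ → E} {n' : ℕ} {v' : ℕ → V}
    {e' : ℕ → E} (h : IsTight G n v e n' v' e') : IsTight G n' v' e' n v e :=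
  ⟨h.h2, h.h1, h.s2, h.s1, h.b.symm, fun y a b => h.b ▸ h.meet y b a, h.ne.symm⟩

lemma IsCy.one {G : SGraph V E} {n : ℕ} {v : ℕ → V} {e : ℕ → E} (h : IsCy G n v e) {g : E}
    (hg : g ∈ ES n e) (hv : ∀ y ∈ G.ends g, y = v 0) : ES n e = {g} := by
  obtain ⟨i, hi, rfl⟩ := hg
  have h1 := hv (v i) (by rw [h.inc i hi]; simp)
  have h2 := hv (v (i + 1)) (by rw [h.inc i hi]; simp)
  have h3 := h.vinj _ hi _ h.pos h1
  subst h3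
  have hn : n = 1 := by
    by_contra hn
    have := h.vinj _ (by have := h.pos; omega) _ h.pos h2
    omega
  subst hn
  ext x; simp [ES]

lemma IsTight.disj {G : SGraph V E} {n : ℕ} {v : ℕ → V} {e : ℕ → E} {n' : ℕ} {v' : ℕ → V}
    {e' : ℕ → E} (h : IsTight G n v e n' v' e') : ∀ g ∈ ES n e, g ∉ ES n' e' := by
  intro g hg hg'
  have hv : ∀ y ∈ G.ends g, y = v 0 := fun y hy => h.meet y (h.h1.mem hg hy) (h.h2.mem hg' hy)
  exact h.ne ((h.h1.one hg hv).trans (h.h2.one hg' (fun y hy => (hv y hy).trans h.b)).symm)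

lemma IsTight.half {G : SGraph V E} {r : E → V →₀ ℚ} (hr : G.IsRep r)
    {n : ℕ} {v : ℕ → V} {e : ℕ → E} {n' : ℕ} {v' : ℕ → V}
    {e' : ℕ → E} (h : IsTight G n v e n' v' e') {l : E →₀ ℚ} (hk : Ker r l)
    (hsup : ∀ g, l g ≠ 0 → g ∈ ES n e ∨ g ∈ ES n' e') (i : ℕ) (hi : i < n) (h0 : l (e i) = 0) :
    l = 0 := by
  have hz : ∀ g ∈ ES n e, l g = 0 := by
    rintro _ ⟨j, hj, rfl⟩
    refine chain_cy hr hk h.h1 ?_ i hi j hj h0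
    intro g hg y hy hy0 hyg
    rcases hsup g hg with h3 | h3
    · exact h3
    · exact absurd (h.meet y hy (h.h2.mem h3 hyg)) hy0
  have hz' := neg_cycle hr hk h.h2 h.s2 (by
    intro g hg y _ _
    rcases hsup g hg with h3 | h3
    · exact absurd (hz g h3) hg
    · exact h3)
  ext g
  by_contra hg
  rcases hsup g hg with h3 | h3
  · exact hg (hz g h3)
  · obtain ⟨j, hj, rfl⟩ := h3
    exact hg (hz' j hj)

lemma not_mem_supp {l : E →₀ ℚ} {S : Set E} (h : (l.support : Set E) ⊆ S) {g : E} (hg : g ∉ S) :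
    l g = 0 := by
  by_contra h'
  exact hg (h (Finsupp.mem_support_iff.2 h'))

lemma IsTight.circ {G : SGraph V E} {r : E → V →₀ ℚ} (hr : G.IsRep r)
    {n : ℕ} {v : ℕ → V} {e : ℕ → E} {n' : ℕ} {v' : ℕ → V}
    {e' : ℕ → E} (h : IsTight G n v e n' v' e') : Circ r (ES n e ∪ ES n' e') := by
  constructor
  · obtain ⟨l, a1, a2, a3⟩ := walk_comb hr v e n h.h1.inc
    obtain ⟨l', b1, b2, -⟩ := walk_comb hr v' e' n' h.h2.inc
    have hne : l (e 0) ≠ 0 := a3 (by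
      intro i hi hin hh
      have := h.h1.einj _ hin _ h.h1.pos hh
      omega) h.h1.pos
    have hz : l' (e 0) = 0 := not_mem_supp b1 (h.disj _ ⟨0, h.h1.pos, rfl⟩)
    refine ⟨l - l', ?_, ?_, ?_⟩
    · intro hh
      apply hne
      have := DFunLike.congr_fun hh (e 0)
      simpa [hz] using this
    · intro x hx
      by_contra hx'
      rw [Set.mem_union, not_or] at hx'
      rw [Finset.mem_coe, Finsupp.mem_support_iff, Finsupp.sub_apply, not_mem_supp a1 hx'.1,
        not_mem_supp b1 hx'.2] at hx
      simp at hx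
    · unfold Ker; rw [map_sub, a2, b2, h.h1.cl, h.h2.cl, h.s1, h.s2, h.b]; simp
  · intro l hl hsup hk x hx
    have hsup' : ∀ g, l g ≠ 0 → g ∈ ES n e ∨ g ∈ ES n' e' :=
      fun g hg => hsup (Finsupp.mem_support_iff.2 hg)
    rw [Finset.mem_coe, Finsupp.mem_support_iff]
    intro h0
    rcases hx with ⟨i, hi, rfl⟩ | ⟨i, hi, rfl⟩
    · exact hl (h.half hr hk hsup' i hi h0)
    · exact hl (h.symm.half hr hk (fun g hg => (hsup' g hg).symm) i hi h0)

structure IsLoose (G : SGraph V E) (n : ℕ) (v : ℕ → V) (e : ℕ → E) (n' : ℕ) (v' : ℕ → V)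
    (e' : ℕ → E) (m : ℕ) (p : ℕ → V) (q : ℕ → E) : Prop where
  h1 : IsCy G n v e
  h2 : IsCy G n' v' e'
  s1 : G.sp e n = -1
  s2 : G.sp e' n' = -1
  pa : IsPa G m p q
  b1 : p 0 = v 0
  b2 : p m = v' 0
  meet : ∀ y ∈ ES n v, y ∉ ES n' v'
  int : ∀ i, 0 < i → i < m → p i ∉ ES n v ∧ p i ∉ ES n' v'

section
variable {G : SGraph V E} {n : ℕ} {v : ℕ → V} {e : ℕ → E} {n' : ℕ} {v' : ℕ → V}
    {e' : ℕ → E} {m : ℕ} {p : ℕ → V} {q : ℕ → E}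

lemma IsLoose.symm (h : IsLoose G n v e n' v' e' m p q) :
    IsLoose G n' v' e' n v e m (fun i => p (m - i)) (fun i => q (m - 1 - i)) :=
  ⟨h.h2, h.h1, h.s2, h.s1, h.pa.rev, by simpa using h.b2, by simpa using h.b1,
    fun y a b => h.meet y b a, fun i hi him => (h.int (m - i) (by omega) (by omega)).symm⟩

lemma IsLoose.p_mem (h : IsLoose G n v e n' v' e' m p q) (j : ℕ) (hj : j ≤ m)
    (hp : p j ∈ ES n v) : j = 0 := by
  by_contra h0
  rcases Nat.lt_or_ge j m with h' | h'
  · exact (h.int j (by omega) h').1 hp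
  · rw [show j = m by omega, h.b2] at hp
    exact h.meet _ hp ⟨0, h.h2.pos, rfl⟩

lemma IsLoose.q_mem (h : IsLoose G n v e n' v' e' m p q) {g : E} (hg : g ∈ ES m q) {y : V}
    (hy : y ∈ G.ends g) (hyv : y ∈ ES n v) : y = v 0 := by
  obtain ⟨j, hj, rfl⟩ := hg
  rw [h.pa.inc j hj, Sym2.mem_iff] at hy
  rcases hy with rfl | rfl
  · rw [h.p_mem j (by omega) hyv, h.b1]
  · rw [h.p_mem _ (by omega) hyv, h.b1]

lemma IsLoose.disj (h : IsLoose G n v e n' v' e' m p q) : ∀ g ∈ ES n e, g ∉ ES n' e' := by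
  rintro _ ⟨i, hi, rfl⟩ hg'
  exact h.meet (v i) ⟨i, hi, rfl⟩ (h.h2.mem hg' (by rw [h.h1.inc i hi]; simp))

lemma IsLoose.disjq (h : IsLoose G n v e n' v' e' m p q) : ∀ g ∈ ES n e, g ∉ ES m q := by
  rintro g hg ⟨j, hj, rfl⟩
  have := h.p_mem (j + 1) (by omega) (h.h1.mem hg (by rw [h.pa.inc j hj]; simp))
  omega

lemma IsLoose.mpos (h : IsLoose G n v e n' v' e' m p q) : 0 < m := by
  rcases Nat.eq_zero_or_pos m with h0 | h0
  · exfalso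
    have := h.b2
    rw [h0, h.b1] at this
    exact h.meet (v 0) ⟨0, h.h1.pos, rfl⟩ ⟨0, h.h2.pos, this.symm⟩
  · exact h0

lemma IsLoose.chainq (h : IsLoose G n v e n' v' e' m p q) {r : E → V →₀ ℚ} (hr : G.IsRep r)
    {l : E →₀ ℚ} (hk : Ker r l)
    (hsup : ∀ g, l g ≠ 0 → g ∈ ES n e ∨ g ∈ ES n' e' ∨ g ∈ ES m q) :
    ∀ i < m, ∀ j < m, l (q i) = 0 → l (q j) = 0 := by
  refine chain_pa hr hk h.pa ?_
  intro g hg i hi him hmem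
  rcases hsup g hg with h3 | h3 | h3
  · exact absurd (h.h1.mem h3 hmem) (h.int i hi him).1
  · exact absurd (h.h2.mem h3 hmem) (h.int i hi him).2
  · exact h3

lemma IsLoose.half (h : IsLoose G n v e n' v' e' m p q) {r : E → V →₀ ℚ} (hr : G.IsRep r)
    {l : E →₀ ℚ} (hk : Ker r l)
    (hsup : ∀ g, l g ≠ 0 → g ∈ ES n e ∨ g ∈ ES n' e' ∨ g ∈ ES m q)
    (i : ℕ) (hi : i < n) (h0 : l (e i) = 0) : l = 0 := by
  have hz : ∀ g ∈ ES n e, l g = 0 := by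
    rintro _ ⟨j, hj, rfl⟩
    refine chain_cy hr hk h.h1 ?_ i hi j hj h0
    intro g hg y hy hy0 hyg
    rcases hsup g hg with h3 | h3 | h3
    · exact h3
    · exact absurd (h.h2.mem h3 hyg) (h.meet y hy)
    · exact absurd (h.q_mem h3 hyg hy) hy0
  have hq0 : l (q 0) = 0 := by
    refine leaf hr hk _ _ _ (h.pa.inc 0 h.mpos) ?_ ?_
    · intro hh
      have := h.pa.vinj 0 (by omega) (0 + 1) (by have := h.mpos; omega) hh
      omega
    · intro g hg hlg hm
      rcases hsup g hlg with h3 | h3 | h3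
      · exact hlg (hz g h3)
      · refine h.meet (p 0) ?_ (h.h2.mem h3 hm)
        rw [h.b1]; exact ⟨0, h.h1.pos, rfl⟩
      · obtain ⟨j, hj, rfl⟩ := h3
        rw [h.pa.inc j hj, Sym2.mem_iff] at hm
        rcases hm with hm | hm
        · have := h.pa.vinj 0 (by omega) j (by omega) hm
          exact hg (by rw [this])
        · have := h.pa.vinj 0 (by omega) (j + 1) (by omega) hm
          omega
  have hzq : ∀ g ∈ ES m q, l g = 0 := by
    rintro _ ⟨j, hj, rfl⟩
    exact h.chainq hr hk hsup 0 h.mpos j hj hq0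
  have hz' := neg_cycle hr hk h.h2 h.s2 (by
    intro g hg y _ _
    rcases hsup g hg with h3 | h3 | h3
    · exact absurd (hz g h3) hg
    · exact h3
    · exact absurd (hzq g h3) hg)
  ext g
  by_contra hg
  rcases hsup g hg with h3 | h3 | h3
  · exact hg (hz g h3)
  · obtain ⟨j, hj, rfl⟩ := h3
    exact hg (hz' j hj)
  · exact hg (hzq g h3)

lemma IsLoose.circ (h : IsLoose G n v e n' v' e' m p q) {r : E → V →₀ ℚ} (hr : G.IsRep r) :
    Circ r (ES n e ∪ ES n' e' ∪ ES m q) := by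
  constructor
  · obtain ⟨l, a1, a2, a3⟩ := walk_comb hr v e n h.h1.inc
    obtain ⟨l', b1, b2, -⟩ := walk_comb hr v' e' n' h.h2.inc
    obtain ⟨k, c1, c2, -⟩ := walk_comb hr p q m h.pa.inc
    have hne : l (e 0) ≠ 0 := a3 (by
      intro i hi hin hh
      have := h.h1.einj _ hin _ h.h1.pos hh
      omega) h.h1.pos
    have hz : l' (e 0) = 0 := not_mem_supp b1 (h.disj _ ⟨0, h.h1.pos, rfl⟩)
    have hz2 : k (e 0) = 0 := not_mem_supp c1 (h.disjq _ ⟨0, h.h1.pos, rfl⟩)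
    refine ⟨l - (2 : ℚ) • k - G.sp q m • l', ?_, ?_, ?_⟩
    · intro hh
      apply hne
      have := DFunLike.congr_fun hh (e 0)
      simpa [hz, hz2] using this
    · intro x hx
      by_contra hx'
      rw [Set.mem_union, Set.mem_union, not_or, not_or] at hx'
      rw [Finset.mem_coe, Finsupp.mem_support_iff, Finsupp.sub_apply, Finsupp.sub_apply,
        Finsupp.smul_apply, Finsupp.smul_apply, not_mem_supp a1 hx'.1.1,
        not_mem_supp b1 hx'.1.2, not_mem_supp c1 hx'.2] at hx
      simp at hx
    · unfold Ker
      rw [map_sub, map_sub, map_smul, map_smul, a2, b2, c2, h.h1.cl, h.h2.cl, h.s1, h.s2, h.b1, h.b2]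
      module
  · intro l hl hsup hk x hx
    have hsup' : ∀ g, l g ≠ 0 → g ∈ ES n e ∨ g ∈ ES n' e' ∨ g ∈ ES m q := by
      intro g hg
      have := hsup (Finsupp.mem_support_iff.2 hg)
      simp only [Set.mem_union] at this
      tauto
    rw [Finset.mem_coe, Finsupp.mem_support_iff]
    intro h0
    rcases hx with (⟨i, hi, rfl⟩ | ⟨i, hi, rfl⟩) | ⟨i, hi, rfl⟩
    · exact hl (h.half hr hk hsup' i hi h0)
    · refine hl (h.symm.half hr hk (fun g hg => ?_) i hi h0)
      rw [ES_rev]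
      have := hsup' g hg
      tauto
    · have hz := neg_cycle hr hk h.h1 h.s1 (by
        intro g hg y hy hyg
        rcases hsup' g hg with h3 | h3 | h3
        · exact h3
        · exact absurd (h.h2.mem h3 hyg) (h.meet y hy)
        · obtain ⟨j, hj, rfl⟩ := h3
          exact absurd (h.chainq hr hk hsup' i hi j hj h0) hg)
      exact hl (h.half hr hk hsup' 0 h.h1.pos (hz 0 h.h1.pos))

end

lemma FrameCircuit.circ {G : SGraph V E} {r : E → V →₀ ℚ} (hr : G.IsRep r) {C : Set E}
    (h : G.FrameCircuit C) : Circ r C := by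
  cases h with
  | pos C h =>
    obtain ⟨n, v, e, hC, -, he, -⟩ := C.toNat (C.vtx 0) ⟨0, rfl⟩
    rw [← he]
    refine pos_circ hr hC (sp_one_iff G e n hC.einj ?_)
    rw [he]; exact h
  | tight C₁ C₂ h₁ h₂ hne x hmeet =>
    have hx : x ∈ C₁.vertices ∩ C₂.vertices := by rw [hmeet]; rfl
    obtain ⟨n, v, e, hC, hb, he, hv⟩ := C₁.toNat x hx.1
    obtain ⟨n', v', e', hC', hb', he', hv'⟩ := C₂.toNat x hx.2
    rw [← he, ← he']
    refine IsTight.circ hr ⟨hC, hC', sp_neg_iff G e n hC.einj ?_, sp_neg_iff G e' n' hC'.einj ?_,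
      hb.trans hb'.symm, ?_, ?_⟩
    · rw [he]; exact h₁
    · rw [he']; exact h₂
    · intro y hy hy'
      have : y ∈ C₁.vertices ∩ C₂.vertices := ⟨hv ▸ hy, hv' ▸ hy'⟩
      rw [hmeet] at this
      rw [hb]; exact this
    · rw [he, he']; exact hne
  | loose C₁ C₂ h₁ h₂ hV P =>
    obtain ⟨m, p, q, hP, p1, p2, p3, hq⟩ := P.toNat (C₁.edge 0)
    obtain ⟨n, v, e, hC, hb, he, hv⟩ := C₁.toNat _ p1
    obtain ⟨n', v', e', hC', hb', he', hv'⟩ := C₂.toNat _ p2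
    rw [← he, ← he', ← hq]
    refine IsLoose.circ ⟨hC, hC', sp_neg_iff G e n hC.einj ?_, sp_neg_iff G e' n' hC'.einj ?_,
      hP, hb.symm, hb'.symm, ?_, ?_⟩ hr
    · rw [he]; exact h₁
    · rw [he']; exact h₂
    · intro y hy hy'
      rw [hv] at hy; rw [hv'] at hy'
      exact Set.disjoint_left.1 hV hy hy'
    · rw [hv, hv']; exact p3

end SGraph
namespace SGraph

variable {V E : Type*}

/-- A non-backtracking walk which is a path up to its last edge. -/
structure Lol (G : SGraph V E) (l : E →₀ ℚ) (S : Set V) (f : E) (u : V) (n : ℕ) (v : ℕ → V)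
    (e : ℕ → E) : Prop where
  inc : ∀ i ≤ n, G.ends (e i) = s(v i, v (i + 1))
  vinj : ∀ i ≤ n, ∀ j ≤ n, v i = v j → i = j
  nb : ∀ i < n, e i ≠ e (i + 1)
  sup : ∀ i ≤ n, l (e i) ≠ 0
  out : ∀ i, 0 < i → i ≤ n → v i ∉ S
  e0 : e 0 = f
  v0 : v 0 = u

lemma Lol.einj {G : SGraph V E} {l : E →₀ ℚ} {S : Set V} {f : E} {u : V} {n : ℕ} {v : ℕ → V}
    {e : ℕ → E} (h : Lol G l S f u n v e) : ∀ i ≤ n, ∀ j ≤ n, e i = e j → i = j := by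
  have key : ∀ i ≤ n, ∀ j ≤ n, i < j → e i ≠ e j := by
    intro i hi j hj hij he
    have h1 : v j ∈ G.ends (e i) := by rw [he, h.inc j hj]; simp
    rw [h.inc i hi, Sym2.mem_iff] at h1
    rcases h1 with h1 | h1
    · have := h.vinj _ hj _ hi h1; omega
    · have := h.vinj _ hj _ (by omega) h1
      subst this
      exact h.nb i (by omega) he
  intro i hi j hj he
  rcases lt_trichotomy i j with h1 | h1 | h1
  · exact absurd he (key i hi j hj h1)
  · exact h1
  · exact absurd he.symm (key j hj i hi h1)

lemma exists_lol {G : SGraph V E} {r : E → V →₀ ℚ} (hr : G.IsRep r) {l : E →₀ ℚ} (hk : Ker r l)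
    (S : Set V) (f : E) (u w : V) (hf : l f ≠ 0) (hfe : G.ends f = s(u, w)) :
    ∃ n v e, Lol G l S f u n v e ∧ (v (n + 1) ∈ S ∨ ∃ j ≤ n, v (n + 1) = v j) := by
  classical
  by_contra hcon
  push Not at hcon
  have all : ∀ n, ∃ v e, Lol G l S f u n v e := by
    intro n
    induction n with
    | zero =>
      refine ⟨fun i => if i = 0 then u else w, fun _ => f, ?_, ?_, ?_, ?_, ?_, ?_, ?_⟩
      · intro i hi; simp [show i = 0 by omega, hfe]
      · intro i hi j hj _; omega
      · intro i hi; omega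
      · intro i hi; exact hf
      · intro i hi; omega
      · rfl
      · rfl
    | succ n ih =>
      obtain ⟨v, e, h⟩ := ih
      obtain ⟨c1, c2⟩ := hcon n v e h
      have : ∃ g, g ≠ e n ∧ l g ≠ 0 ∧ v (n + 1) ∈ G.ends g := by
        by_contra hno
        push Not at hno
        refine h.sup n le_rfl (leaf hr hk (e n) (v (n + 1)) (v n) ?_ (c2 n le_rfl) hno)
        rw [h.inc n le_rfl, Sym2.eq_swap]
      obtain ⟨g, g1, g2, g3⟩ := this
      obtain ⟨x, hx⟩ := Sym2.mem_iff_exists.1 g3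
      refine ⟨fun i => if i ≤ n + 1 then v i else x, fun i => if i ≤ n then e i else g,
        ?_, ?_, ?_, ?_, ?_, ?_, ?_⟩
      · intro i hi
        rcases Nat.lt_or_ge n i with h1 | h1
        · have : i = n + 1 := by omega
          subst this
          simp [hx]
        · simp [h1, h.inc i h1, show i ≤ n + 1 by omega]
      · intro i hi j hj hij
        simp only [hi, hj, if_true] at hij
        rcases Nat.lt_or_ge n i with h1 | h1 <;> rcases Nat.lt_or_ge n j with h2 | h2
        · omega
        · rw [show i = n + 1 by omega] at hij
          exact absurd hij (c2 j h2)
        · rw [show j = n + 1 by omega] at hij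
          exact absurd hij.symm (c2 i h1)
        · exact h.vinj i h1 j h2 hij
      · intro i hi
        rcases Nat.lt_or_ge i n with h1 | h1
        · simp only [show i ≤ n by omega, show i + 1 ≤ n by omega, if_true]
          exact h.nb i h1
        · have : i = n := by omega
          subst this
          simpa using g1.symm
      · intro i hi
        rcases Nat.lt_or_ge n i with h1 | h1
        · simpa [show ¬ i ≤ n by omega] using g2
        · simpa [h1] using h.sup i h1
      · intro i hi hin
        simp only [hin, if_true]
        rcases Nat.lt_or_ge n i with h1 | h1
        · rw [show i = n + 1 by omega]; exact c1
        · exact h.out i hi h1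
      · simpa using h.e0
      · simpa using h.v0
  obtain ⟨v, e, h⟩ := all l.support.card
  have := Finset.card_le_card_of_injOn (s := Finset.range (l.support.card + 1)) (t := l.support) e
    (by
      intro i hi
      simp at hi
      exact Finsupp.mem_support_iff.2 (h.sup i (by omega)))
    (by
      intro i hi j hj hij
      simp at hi hj
      exact h.einj i (by omega) j (by omega) hij)
  simp at this

/-- The cycle closing a lollipop. -/
lemma Lol.cy {G : SGraph V E} {l : E →₀ ℚ} {S : Set V} {f : E} {u : V} {n : ℕ} {v : ℕ → V}
    {e : ℕ → E} (h : Lol G l S f u n v e) {j : ℕ} (hj : j ≤ n) (hv : v (n + 1) = v j) :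
    IsCy G (n + 1 - j) (fun i => v (j + i)) (fun i => e (j + i)) := by
  refine ⟨by omega, ?_, ?_, ?_, ?_⟩
  · intro i hi; exact h.inc _ (by omega)
  · simpa [show j + (n + 1 - j) = n + 1 by omega] using hv
  · intro i hi k hk hik; have := h.vinj _ (by omega) _ (by omega) hik; omega
  · intro i hi k hk hik; have := h.einj _ (by omega) _ (by omega) hik; omega

lemma glue {G : SGraph V E} {n m : ℕ} {v p : ℕ → V} {e q : ℕ → E} (h1 : IsPa G n v e)
    (h2 : IsPa G m p q) (hn : 0 < n) (hm : 0 < m) (b1 : v n = p 0) (b2 : p m = v 0)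
    (hd : ∀ i ≤ n, ∀ j, 0 < j → j < m → v i ≠ p j)
    (he : ∀ i < n, ∀ j < m, e i ≠ q j) :
    ∃ k v' e', IsCy G k v' e' ∧ ES k e' = ES n e ∪ ES m q := by
  refine ⟨n + m, fun i => if i ≤ n then v i else p (i - n), fun i => if i < n then e i else q (i - n),
    ⟨by omega, ?_, ?_, ?_, ?_⟩, ?_⟩
  · intro i hi
    rcases Nat.lt_or_ge i n with h | h
    · simp [h, h.le, show i + 1 ≤ n by omega, h1.inc i h]
    · have : (if i ≤ n then v i else p (i - n)) = p (i - n) := by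
        split_ifs with h'
        · rw [show i = n by omega, b1]; simp
        · rfl
      simp only [this, show ¬ i < n by omega, show ¬ i + 1 ≤ n by omega, if_false]
      rw [h2.inc _ (by omega), show i + 1 - n = i - n + 1 by omega]
  · simp [show ¬ (n + m ≤ n) by omega, b2]
  · intro i hi j hj hij
    rcases Nat.lt_or_ge n i with h | h <;> rcases Nat.lt_or_ge n j with h' | h'
    · simp only [show ¬ i ≤ n by omega, show ¬ j ≤ n by omega, if_false] at hij
      have := h2.vinj _ (by omega) _ (by omega) hij
      omega
    · simp only [show ¬ i ≤ n by omega, h', if_false, if_true] at hij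
      exact absurd hij.symm (hd _ h' _ (by omega) (by omega))
    · simp only [show ¬ j ≤ n by omega, h, if_false, if_true] at hij
      exact absurd hij (hd _ h _ (by omega) (by omega))
    · simp only [h, h', if_true] at hij
      exact h1.vinj _ h _ h' hij
  · intro i hi j hj hij
    rcases Nat.lt_or_ge i n with h | h <;> rcases Nat.lt_or_ge j n with h' | h'
    · simp only [h, h', if_true] at hij
      exact h1.einj _ h _ h' hij
    · simp only [h, show ¬ j < n by omega, if_true, if_false] at hij
      exact absurd hij (he _ h _ (by omega))
    · simp only [h', show ¬ i < n by omega, if_true, if_false] at hij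
      exact absurd hij.symm (he _ h' _ (by omega))
    · simp only [show ¬ i < n by omega, show ¬ j < n by omega, if_false] at hij
      have := h2.einj _ (by omega) _ (by omega) hij
      omega
  · ext x; constructor
    · rintro ⟨i, hi, rfl⟩
      by_cases h : i < n
      · left; exact ⟨i, h, by simp [h]⟩
      · right; exact ⟨i - n, by omega, by simp [h]⟩
    · rintro (⟨i, hi, rfl⟩ | ⟨i, hi, rfl⟩)
      · exact ⟨i, by omega, by simp [hi]⟩
      · exact ⟨n + i, by omega, by simp⟩

lemma IsCy.pos_frame {G : SGraph V E} {n : ℕ} {v : ℕ → V} {e : ℕ → E} (h : IsCy G n v e)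
    (hs : Even (ES n e ∩ G.neg).ncard) : G.FrameCircuit (ES n e) := by
  obtain ⟨C, hC, -⟩ := h.toCyc
  rw [← hC]
  refine .pos C ?_
  unfold Cyc.Positive Cyc.PositiveIn
  rwa [hC]

lemma ES_fin {α : Type*} (n : ℕ) (e : ℕ → α) : (ES n e).Finite := by
  have : ES n e = e '' (Set.Iio n) := by ext x; simp [ES]
  rw [this]; exact (Set.finite_Iio n).image e

lemma ncard_un (N : Set E) {A B : Set E} (hA : A.Finite) (hB : B.Finite) (h : ∀ x ∈ A, x ∉ B) :
    ((A ∪ B) ∩ N).ncard = (A ∩ N).ncard + (B ∩ N).ncard := by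
  rw [Set.union_inter_distrib_right]
  exact Set.ncard_union_eq (Set.disjoint_left.2 fun x hx hx' => h x hx.1 hx'.1)
    (hA.subset Set.inter_subset_left) (hB.subset Set.inter_subset_left)

/-- A theta graph containing a negative cycle contains a positive one. -/
lemma theta {G : SGraph V E} {n : ℕ} {v : ℕ → V} {e : ℕ → E} (h : IsCy G n v e)
    (hs : ¬ Even (ES n e ∩ G.neg).ncard) {a : ℕ} (ha : 0 < a) (han : a < n)
    {m : ℕ} {p : ℕ → V} {q : ℕ → E} (hp : IsPa G m p q) (b1 : p 0 = v 0) (b2 : p m = v a)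
    (hinner : ∀ i, 0 < i → i < m → p i ∉ ES n v) (hq : ∀ i < m, q i ∉ ES n e) :
    ∃ F, G.FrameCircuit F ∧ F ⊆ ES n e ∪ ES m q := by
  have hm : 0 < m := by
    rcases Nat.eq_zero_or_pos m with h0 | h0
    · rw [h0, b1] at b2
      have := h.vinj _ h.pos _ han b2; omega
    · exact h0
  have P1 : IsPa G a v e := ⟨fun i hi => h.inc i (by omega),
    fun i hi j hj hij => h.vinj i (by omega) j (by omega) hij⟩
  have hvn : ∀ i, 0 < i → i ≤ n → ∀ j, 0 < j → j ≤ n → v i = v j → i = j := by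
    intro i hi hin j hj hjn hij
    rcases Nat.lt_or_ge i n with h1 | h1 <;> rcases Nat.lt_or_ge j n with h2 | h2
    · exact h.vinj _ h1 _ h2 hij
    · rw [show j = n by omega, h.cl] at hij
      have := h.vinj _ h1 _ h.pos hij; omega
    · rw [show i = n by omega, h.cl] at hij
      have := h.vinj _ h.pos _ h2 hij; omega
    · omega
  have P2 : IsPa G (n - a) (fun i => v (a + i)) (fun i => e (a + i)) := by
    refine ⟨fun i hi => h.inc _ (by omega), fun i hi j hj hij => ?_⟩
    have := hvn _ (by omega) (by omega) _ (by omega) (by omega) hij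
    omega
  have hmem : ∀ i ≤ n, v i ∈ ES n v := by
    intro i hi
    rcases Nat.lt_or_ge i n with h1 | h1
    · exact ⟨i, h1, rfl⟩
    · exact ⟨0, h.pos, by rw [show i = n by omega, h.cl]⟩
  obtain ⟨k, v1, e1, C1, E1⟩ := glue P1 hp.rev ha hm (by simp [b2]) (by simp [b1])
    (by
      intro i hi j hj hjm hh
      exact hinner (m - j) (by omega) (by omega) (hh ▸ hmem i (by omega)))
    (by
      intro i hi j hj hh
      exact hq (m - 1 - j) (by omega) ⟨i, by omega, hh⟩)
  obtain ⟨k', v2, e2, C2, E2⟩ := glue hp P2 hm (by omega) (by simp [b2])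
    (by simp [show a + (n - a) = n by omega, h.cl, b1])
    (by
      intro i hi j hj hjm hh
      rcases Nat.eq_zero_or_pos i with h0 | h0
      · subst h0
        rw [b1, ← h.cl] at hh
        have := hvn _ h.pos le_rfl _ (by omega) (by omega) hh
        omega
      · rcases Nat.lt_or_ge i m with h1 | h1
        · exact hinner i h0 h1 (hh ▸ hmem _ (by omega))
        · rw [show i = m by omega, b2] at hh
          have := hvn _ ha (by omega) _ (by omega) (by omega) hh
          omega)
    (by
      intro i hi j hj hh
      exact hq i hi ⟨a + j, by omega, hh.symm⟩)
  rw [ES_rev] at E1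
  have EE : ES n e = ES a e ∪ ES (n - a) (fun i => e (a + i)) := by
    ext x; constructor
    · rintro ⟨i, hi, rfl⟩
      by_cases h' : i < a
      · left; exact ⟨i, h', rfl⟩
      · right; exact ⟨i - a, by omega, by simp [show a + (i - a) = i by omega]⟩
    · rintro (⟨i, hi, rfl⟩ | ⟨i, hi, rfl⟩)
      · exact ⟨i, by omega, rfl⟩
      · exact ⟨a + i, by omega, rfl⟩
  have n0 := ncard_un G.neg (ES_fin a e) (ES_fin (n - a) (fun i => e (a + i))) (by
    rintro _ ⟨i, hi, rfl⟩ ⟨j, hj, hh⟩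
    have := h.einj _ (by omega) _ (by omega) hh
    omega)
  have n1 := ncard_un G.neg (ES_fin a e) (ES_fin m q) (by
    rintro _ ⟨i, hi, rfl⟩ ⟨j, hj, hh⟩
    exact hq j hj ⟨i, by omega, hh.symm⟩)
  have n2 := ncard_un G.neg (ES_fin m q) (ES_fin (n - a) (fun i => e (a + i))) (by
    rintro _ ⟨j, hj, rfl⟩ ⟨i, hi, hh⟩
    exact hq j hj ⟨a + i, by omega, hh⟩)
  rw [← EE] at n0
  rw [← E1] at n1
  rw [← E2] at n2
  by_cases hA : Even (ES k e1 ∩ G.neg).ncard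
  · refine ⟨_, C1.pos_frame hA, ?_⟩
    rw [E1, EE]
    intro x; simp only [Set.mem_union]; tauto
  · refine ⟨_, C2.pos_frame ?_, ?_⟩
    · rw [n2]; rw [n0] at hs; rw [n1] at hA
      rw [Nat.even_iff] at *
      omega
    · rw [E2, EE]
      intro x; simp only [Set.mem_union]; tauto

lemma IsCy.rebase {G : SGraph V E} {n : ℕ} {v : ℕ → V} {e : ℕ → E} (h : IsCy G n v e) {b : V}
    (hb : b ∈ ES n v) : ∃ n' v' e', IsCy G n' v' e' ∧ v' 0 = b ∧ ES n' e' = ES n e ∧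
      ES n' v' = ES n v := by
  obtain ⟨C, h1, h2⟩ := h.toCyc
  rw [← h1, ← h2]
  exact C.toNat b (h2 ▸ hb)

/-- Every dependency supports a frame circuit. -/
lemma exists_frame {G : SGraph V E} {r : E → V →₀ ℚ} (hr : G.IsRep r) {l : E →₀ ℚ} (hk : Ker r l)
    (hl : l ≠ 0) : ∃ F, G.FrameCircuit F ∧ F ⊆ (l.support : Set E) := by
  obtain ⟨f, hf⟩ := Finsupp.ne_iff.1 hl
  obtain ⟨⟨u, w⟩, huw⟩ := Quot.exists_rep (G.ends f)
  obtain ⟨n, v, e, h, h' | ⟨j, hj, hv⟩⟩ := exists_lol hr hk ∅ f u w hf huw.symm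
  · exact absurd h' (by simp)
  have hC := h.cy hj hv
  have hsup : ∀ g ∈ ES (n + 1 - j) (fun i => e (j + i)), l g ≠ 0 := by
    rintro _ ⟨i, hi, rfl⟩; exact h.sup _ (by omega)
  generalize n + 1 - j = n₁ at hC hsup
  generalize (fun i => v (j + i)) = v₁ at hC
  generalize (fun i => e (j + i)) = e₁ at hC hsup
  clear h hv hj huw hf
  by_cases hs : Even (ES n₁ e₁ ∩ G.neg).ncard
  · exact ⟨_, hC.pos_frame hs, fun g hg => Finsupp.mem_support_iff.2 (hsup g hg)⟩
  have : ∃ g, l g ≠ 0 ∧ ∃ y ∈ ES n₁ v₁, y ∈ G.ends g ∧ g ∉ ES n₁ e₁ := by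
    by_contra hno
    push Not at hno
    exact hsup (e₁ 0) ⟨0, hC.pos, rfl⟩
      (neg_cycle hr hk hC (sp_neg_iff G _ _ hC.einj hs) hno 0 hC.pos)
  obtain ⟨g, hg, y, hy, hyg, hge⟩ := this
  obtain ⟨n₂, v₂, e₂, hC₂, hb, he, hv₂⟩ := hC.rebase hy
  rw [← he] at hs hsup hge
  clear hy hv₂ he hC
  obtain ⟨x, hx⟩ := Sym2.mem_iff_exists.1 hyg
  obtain ⟨m, p, q, hL, hend⟩ := exists_lol hr hk (ES n₂ v₂) g y x hg hx
  have hq : ∀ i ≤ m, q i ∉ ES n₂ e₂ := by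
    intro i hi
    rcases Nat.eq_zero_or_pos i with h0 | h0
    · rw [h0, hL.e0]; exact hge
    · intro hc
      exact hL.out i h0 hi (hC₂.mem hc (by rw [hL.inc i hi]; simp))
  have hp0 : p 0 = v₂ 0 := hL.v0.trans hb.symm
  by_cases hj : ∃ j ≤ m, p (m + 1) = p j
  · obtain ⟨j, hj, hpj⟩ := hj
    have hC₃ := hL.cy hj hpj
    have hsup₃ : ∀ g ∈ ES (m + 1 - j) (fun i => q (j + i)), l g ≠ 0 := by
      rintro _ ⟨i, hi, rfl⟩; exact hL.sup _ (by omega)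
    by_cases hs₃ : Even (ES (m + 1 - j) (fun i => q (j + i)) ∩ G.neg).ncard
    · exact ⟨_, hC₃.pos_frame hs₃, fun g hg => Finsupp.mem_support_iff.2 (hsup₃ g hg)⟩
    obtain ⟨D₂, d1, d2⟩ := hC₂.toCyc
    obtain ⟨D₃, d3, d4⟩ := hC₃.toCyc
    have neg2 : D₂.Negative := by
      unfold Cyc.Negative Cyc.Positive Cyc.PositiveIn; rwa [d1]
    have neg3 : D₃.Negative := by
      unfold Cyc.Negative Cyc.Positive Cyc.PositiveIn; rwa [d3]
    rcases Nat.eq_zero_or_pos j with h0 | h0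
    · subst h0
      refine ⟨_, .tight D₂ D₃ neg2 neg3 ?_ (v₂ 0) ?_, ?_⟩
      · rw [d1, d3]
        intro hh
        apply hq 0 (by omega)
        rw [hh]
        exact ⟨0, by omega, rfl⟩
      · rw [d2, d4]
        ext z
        simp only [Set.mem_inter_iff, Set.mem_singleton_iff]
        constructor
        · rintro ⟨hz, ⟨i, hi, rfl⟩⟩
          rcases Nat.eq_zero_or_pos i with h1 | h1
          · simpa [h1] using hp0
          · exact absurd hz (hL.out _ (by omega) (by omega))
        · rintro rfl
          exact ⟨⟨0, hC₂.pos, rfl⟩, ⟨0, by omega, by simpa using hp0⟩⟩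
      · rw [d1, d3]
        rintro z (hz | hz)
        · exact Finsupp.mem_support_iff.2 (hsup z hz)
        · exact Finsupp.mem_support_iff.2 (hsup₃ z hz)
    · have hP : IsPa G j p q := ⟨fun i hi => hL.inc i (by omega),
        fun i hi k hk hik => hL.vinj i (by omega) k (by omega) hik⟩
      obtain ⟨P, hPe⟩ := hP.toConn (S := D₂.vertices) (T := D₃.vertices)
        (by rw [d2, hp0]; exact ⟨0, hC₂.pos, rfl⟩)
        (by rw [d4]; exact ⟨0, by omega, rfl⟩)
        (by
          intro i hi hij
          rw [d2, d4]
          refine ⟨hL.out i hi (by omega), ?_⟩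
          rintro ⟨k, hk, hh⟩
          have := hL.vinj _ (by omega) _ (by omega) hh
          omega)
      refine ⟨_, .loose D₂ D₃ neg2 neg3 ?_ P, ?_⟩
      · rw [d2, d4, Set.disjoint_left]
        rintro z hz ⟨i, hi, rfl⟩
        exact hL.out _ (by omega) (by omega) hz
      · rw [d1, d3, hPe]
        rintro z ((hz | hz) | ⟨i, hi, rfl⟩)
        · exact Finsupp.mem_support_iff.2 (hsup z hz)
        · exact Finsupp.mem_support_iff.2 (hsup₃ z hz)
        · exact Finsupp.mem_support_iff.2 (hL.sup i (by omega))
  · obtain ⟨a, ha, hpa⟩ := hend.resolve_right hj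
    have ha0 : 0 < a := by
      rcases Nat.eq_zero_or_pos a with h0 | h0
      · exfalso; apply hj
        exact ⟨0, by omega, by rw [← hpa, h0, hp0]⟩
      · exact h0
    push Not at hj
    have hP : IsPa G (m + 1) p q := by
      refine ⟨fun i hi => hL.inc i (by omega), ?_⟩
      intro i hi k hk hik
      rcases Nat.lt_or_ge m i with h1 | h1 <;> rcases Nat.lt_or_ge m k with h2 | h2
      · omega
      · rw [show i = m + 1 by omega] at hik
        exact absurd hik (hj k h2)
      · rw [show k = m + 1 by omega] at hik
        exact absurd hik.symm (hj i h1)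
      · exact hL.vinj i h1 k h2 hik
    obtain ⟨F, hF, hFs⟩ := theta hC₂ hs ha0 ha hP hp0 hpa.symm
      (fun i hi him => hL.out i hi (by omega)) (fun i hi => hq i (by omega))
    refine ⟨F, hF, fun z hz => ?_⟩
    rcases hFs hz with hz | ⟨i, hi, rfl⟩
    · exact Finsupp.mem_support_iff.2 (hsup z hz)
    · exact Finsupp.mem_support_iff.2 (hL.sup i (by omega))

lemma frame_iff {G : SGraph V E} {r : E → V →₀ ℚ} (hr : G.IsRep r) (C : Set E) :
    G.FrameCircuit C ↔ Circ r C := by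
  refine ⟨fun h => h.circ hr, ?_⟩
  rintro ⟨⟨l, hl, hs, hk⟩, hmin⟩
  obtain ⟨F, hF, hFl⟩ := exists_frame hr hk hl
  obtain ⟨l', hl', hs', hk'⟩ := (hF.circ hr).1
  have := hmin l' hl' (hs'.trans (hFl.trans hs)) hk'
  rwa [show C = F from Set.Subset.antisymm (this.trans hs') (hFl.trans hs)]

end SGraph
namespace SGraph

variable {V E : Type*}

lemma Circ_congr {V' : Type*} {r : E → V →₀ ℚ} {r' : E → V' →₀ ℚ} (h : ∀ l, Ker r l ↔ Ker r' l)
    (C : Set E) : Circ r C ↔ Circ r' C := by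
  unfold Circ; simp only [h]

/-- Every signed graph has a representation. -/
lemma exists_rep (G : SGraph V E) : ∃ r, G.IsRep r := by
  have : ∀ e, ∃ x : V × V, G.ends e = s(x.1, x.2) := by
    intro e
    obtain ⟨⟨u, w⟩, h⟩ := Quot.exists_rep (G.ends e)
    exact ⟨(u, w), h.symm⟩
  choose x hx using this
  refine ⟨fun e => Finsupp.single (x e).1 1 - G.sg e • Finsupp.single (x e).2 1, ?_⟩
  intro e a b hab
  rw [hx e, Sym2.eq_iff] at hab
  rcases hab with ⟨h1, h2⟩ | ⟨h1, h2⟩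
  · exact ⟨1, one_ne_zero, by simp [h1, h2]⟩
  · refine ⟨- G.sg e, neg_ne_zero.2 (sg_ne G e), ?_⟩
    simp only [h1, h2]
    rw [smul_sub, smul_smul, neg_mul, sg_sq]
    module

/-- The linear map realising the flip. -/
noncomputable def flip {V₁ V₂ : Type*} (s t s' t' : V₂) : (V₁ ⊕ V₂ →₀ ℚ) →ₗ[ℚ] (V₁ ⊕ V₂ →₀ ℚ) :=
  Finsupp.linearCombination ℚ (Sum.elim
    (fun a => Finsupp.single (Sum.inl a) (1 : ℚ)
      - (1 / 2 : ℚ) • (Finsupp.single (Sum.inr s) (1 : ℚ) + Finsupp.single (Sum.inr t) (1 : ℚ))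
      + (1 / 2 : ℚ) • (Finsupp.single (Sum.inr s') (1 : ℚ) + Finsupp.single (Sum.inr t') (1 : ℚ)))
    (fun b => - Finsupp.single (Sum.inr b) (1 : ℚ)
      + (1 / 2 : ℚ) • (Finsupp.single (Sum.inr s) (1 : ℚ) + Finsupp.single (Sum.inr t) (1 : ℚ))
      + (1 / 2 : ℚ) • (Finsupp.single (Sum.inr s') (1 : ℚ) + Finsupp.single (Sum.inr t') (1 : ℚ))))

lemma flip_inl {V₁ V₂ : Type*} (s t s' t' : V₂) (a : V₁) :
    flip s t s' t' (Finsupp.single (Sum.inl a) (1 : ℚ)) = Finsupp.single (Sum.inl a) (1 : ℚ)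
      - (1 / 2 : ℚ) • (Finsupp.single (Sum.inr s) (1 : ℚ) + Finsupp.single (Sum.inr t) (1 : ℚ))
      + (1 / 2 : ℚ) • (Finsupp.single (Sum.inr s') (1 : ℚ) + Finsupp.single (Sum.inr t') (1 : ℚ)) := by
  unfold flip; rw [Finsupp.linearCombination_single, one_smul]; rfl

lemma flip_inr {V₁ V₂ : Type*} (s t s' t' : V₂) (b : V₂) :
    flip (V₁ := V₁) s t s' t' (Finsupp.single (Sum.inr b) (1 : ℚ)) =
      - Finsupp.single (Sum.inr b) (1 : ℚ)
      + (1 / 2 : ℚ) • (Finsupp.single (Sum.inr s) (1 : ℚ) + Finsupp.single (Sum.inr t) (1 : ℚ))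
      + (1 / 2 : ℚ) • (Finsupp.single (Sum.inr s') (1 : ℚ) + Finsupp.single (Sum.inr t') (1 : ℚ)) := by
  unfold flip; rw [Finsupp.linearCombination_single, one_smul]; rfl

lemma flip_flip {V₁ V₂ : Type*} (s t s' t' : V₂) (x : V₁ ⊕ V₂ →₀ ℚ) :
    flip s t s' t' (flip s t s' t' x) = x := by
  have : (flip (V₁ := V₁) s t s' t') ∘ₗ (flip s t s' t') = LinearMap.id := by
    apply Finsupp.lhom_ext'
    intro y
    apply LinearMap.ext_ring
    rcases y with a | b
    · simp only [LinearMap.comp_apply, Finsupp.lsingle_apply, LinearMap.id_apply, flip_inl, map_add,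
        map_sub, map_smul, flip_inr]
      module
    · simp only [LinearMap.comp_apply, Finsupp.lsingle_apply, LinearMap.id_apply, map_add, map_neg,
        map_smul, flip_inr]
      module
  exact LinearMap.congr_fun this x

lemma ker_flip {V₁ V₂ : Type*} (s t s' t' : V₂) (r : E → V₁ ⊕ V₂ →₀ ℚ) (l : E →₀ ℚ) :
    Ker r l ↔ Ker (fun e => flip s t s' t' (r e)) l := by
  have key : Finsupp.linearCombination ℚ (fun e => flip s t s' t' (r e)) l =
      flip s t s' t' (Finsupp.linearCombination ℚ r l) := by
    rw [Finsupp.linearCombination_apply, Finsupp.linearCombination_apply, Finsupp.sum, Finsupp.sum,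
      map_sum]
    simp
  unfold Ker
  rw [key]
  constructor
  · intro h; rw [h, map_zero]
  · intro h; rw [← flip_flip s t s' t' (Finsupp.linearCombination ℚ r l), h, map_zero]

/-- It is enough to check the representation property for one orientation. -/
lemma isRep_of {G : SGraph V E} {r : E → V →₀ ℚ}
    (h : ∀ e, ∃ a b, G.ends e = s(a, b) ∧ ∃ ε : ℚ, ε ≠ 0 ∧
      r e = ε • (Finsupp.single a (1 : ℚ) - G.sg e • Finsupp.single b (1 : ℚ))) : G.IsRep r := by
  intro e a b hab
  obtain ⟨c, d, hcd, ε, hε, hre⟩ := h e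
  rw [hcd, Sym2.eq_iff] at hab
  rcases hab with ⟨rfl, rfl⟩ | ⟨rfl, rfl⟩
  · exact ⟨ε, hε, hre⟩
  · refine ⟨ε * - G.sg e, mul_ne_zero hε (neg_ne_zero.2 (sg_ne G e)), ?_⟩
    rw [hre, mul_smul, smul_sub (-G.sg e), smul_smul, neg_mul, sg_sq]
    module

lemma flip_isRep {V₁ V₂ E₁ E₂ : Type*} (H₁ : SGraph V₁ E₁) (H₂ : SGraph V₂ E₂)
    (hpos₁ : H₁.neg = ∅) (hpos₂ : H₂.neg = ∅)
    (s₁ s₂ t₁ t₂ : V₁) (s₁' s₂' t₁' t₂' : V₂) {r : E₁ ⊕ E₂ ⊕ Fin 4 → V₁ ⊕ V₂ →₀ ℚ}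
    (hr : (glueWith H₁ H₂ ![(s₁, s₁'), (s₂, s₂'), (t₁, t₁'), (t₂, t₂')]).IsRep r) :
    (glueWith H₁ H₂ ![(s₁, s₂'), (s₂, s₁'), (t₁, t₂'), (t₂, t₁')]).IsRep
      (fun e => flip s₁' s₂' t₁' t₂' (r e)) := by
  have sg1 : ∀ c (e : E₁), (glueWith H₁ H₂ c).sg (Sum.inl e) = 1 := by
    intro c e; simp [sg, glueWith, hpos₁]
  have sg2 : ∀ c (e : E₂), (glueWith H₁ H₂ c).sg (Sum.inr (Sum.inl e)) = 1 := by
    intro c e; simp [sg, glueWith, hpos₂]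
  have sg30 : ∀ c, (glueWith H₁ H₂ c).sg (Sum.inr (Sum.inr 0)) = 1 := by
    intro c; simp [sg, glueWith]
  have sg31 : ∀ c, (glueWith H₁ H₂ c).sg (Sum.inr (Sum.inr 1)) = 1 := by
    intro c; simp [sg, glueWith]
  have sg32 : ∀ c, (glueWith H₁ H₂ c).sg (Sum.inr (Sum.inr 2)) = -1 := by
    intro c; simp [sg, glueWith]
  have sg33 : ∀ c, (glueWith H₁ H₂ c).sg (Sum.inr (Sum.inr 3)) = -1 := by
    intro c; simp [sg, glueWith]
  apply isRep_of
  rintro (e | e | i)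
  · obtain ⟨⟨a, b⟩, hab⟩ := Quot.exists_rep (H₁.ends e)
    have hab' : ∀ c, (glueWith H₁ H₂ c).ends (Sum.inl e) = s(Sum.inl a, Sum.inl b) := by
      intro c; simp only [glueWith]; rw [← hab]; rfl
    refine ⟨_, _, hab' _, ?_⟩
    obtain ⟨ε, hε, h⟩ := hr _ _ _ (hab' _)
    refine ⟨ε, hε, ?_⟩
    rw [h, sg1, sg1]
    simp only [map_smul, map_sub, flip_inl]
    module
  · obtain ⟨⟨a, b⟩, hab⟩ := Quot.exists_rep (H₂.ends e)
    have hab' : ∀ c, (glueWith H₁ H₂ c).ends (Sum.inr (Sum.inl e)) = s(Sum.inr a, Sum.inr b) := by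
      intro c; simp only [glueWith]; rw [← hab]; rfl
    refine ⟨_, _, hab' _, ?_⟩
    obtain ⟨ε, hε, h⟩ := hr _ _ _ (hab' _)
    refine ⟨-ε, neg_ne_zero.2 hε, ?_⟩
    rw [h, sg2, sg2]
    simp only [map_smul, map_sub, flip_inr]
    module
  · have hab' : ∀ c, (glueWith H₁ H₂ c).ends (Sum.inr (Sum.inr i)) =
        s(Sum.inl (c i).1, Sum.inr (c i).2) := fun c => rfl
    refine ⟨_, _, hab' _, ?_⟩
    obtain ⟨ε, hε, h⟩ := hr _ _ _ (hab' _)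
    refine ⟨ε, hε, ?_⟩
    rw [h]
    fin_cases i
    · change flip s₁' s₂' t₁' t₂' (ε • (Finsupp.single (Sum.inl s₁) (1 : ℚ)
          - (glueWith H₁ H₂ ![(s₁, s₁'), (s₂, s₂'), (t₁, t₁'), (t₂, t₂')]).sg (Sum.inr (Sum.inr 0))
            • Finsupp.single (Sum.inr s₁') (1 : ℚ))) =
        ε • (Finsupp.single (Sum.inl s₁) (1 : ℚ)
          - (glueWith H₁ H₂ ![(s₁, s₂'), (s₂, s₁'), (t₁, t₂'), (t₂, t₁')]).sg (Sum.inr (Sum.inr 0))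
            • Finsupp.single (Sum.inr s₂') (1 : ℚ))
      simp only [sg30, map_smul, map_sub, flip_inl, flip_inr]
      module
    · change flip s₁' s₂' t₁' t₂' (ε • (Finsupp.single (Sum.inl s₂) (1 : ℚ)
          - (glueWith H₁ H₂ ![(s₁, s₁'), (s₂, s₂'), (t₁, t₁'), (t₂, t₂')]).sg (Sum.inr (Sum.inr 1))
            • Finsupp.single (Sum.inr s₂') (1 : ℚ))) =
        ε • (Finsupp.single (Sum.inl s₂) (1 : ℚ)
          - (glueWith H₁ H₂ ![(s₁, s₂'), (s₂, s₁'), (t₁, t₂'), (t₂, t₁')]).sg (Sum.inr (Sum.inr 1))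
            • Finsupp.single (Sum.inr s₁') (1 : ℚ))
      simp only [sg31, map_smul, map_sub, flip_inl, flip_inr]
      module
    · change flip s₁' s₂' t₁' t₂' (ε • (Finsupp.single (Sum.inl t₁) (1 : ℚ)
          - (glueWith H₁ H₂ ![(s₁, s₁'), (s₂, s₂'), (t₁, t₁'), (t₂, t₂')]).sg (Sum.inr (Sum.inr 2))
            • Finsupp.single (Sum.inr t₁') (1 : ℚ))) =
        ε • (Finsupp.single (Sum.inl t₁) (1 : ℚ)
          - (glueWith H₁ H₂ ![(s₁, s₂'), (s₂, s₁'), (t₁, t₂'), (t₂, t₁')]).sg (Sum.inr (Sum.inr 2))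
            • Finsupp.single (Sum.inr t₂') (1 : ℚ))
      simp only [sg32, map_smul, map_sub, flip_inl, flip_inr]
      module
    · change flip s₁' s₂' t₁' t₂' (ε • (Finsupp.single (Sum.inl t₂) (1 : ℚ)
          - (glueWith H₁ H₂ ![(s₁, s₁'), (s₂, s₂'), (t₁, t₁'), (t₂, t₂')]).sg (Sum.inr (Sum.inr 3))
            • Finsupp.single (Sum.inr t₂') (1 : ℚ))) =
        ε • (Finsupp.single (Sum.inl t₂) (1 : ℚ)
          - (glueWith H₁ H₂ ![(s₁, s₂'), (s₂, s₁'), (t₁, t₂'), (t₂, t₁')]).sg (Sum.inr (Sum.inr 3))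
            • Finsupp.single (Sum.inr t₁') (1 : ℚ))
      simp only [sg33, map_smul, map_sub, flip_inl, flip_inr]
      module

end SGraph

/-- Cylinder flip lemma: if `H₁` and `H₂` have only positive
edges, `Ω` is obtained by adding positive edges `{s₁,s₁'}, {s₂,s₂'}` and
negative edges `{t₁,t₁'}, {t₂,t₂'}`, and `Ω'` by adding positive edges
`{s₁,s₂'}, {s₂,s₁'}` and negative edges `{t₁,t₂'}, {t₂,t₁'}`, then under the
natural identification of edge sets, `M(Ω) = M(Ω')`. -/
theorem cylinder_flip_lemma
    {V₁ V₂ E₁ E₂ : Type*} (H₁ : SGraph V₁ E₁) (H₂ : SGraph V₂ E₂)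
    (hpos₁ : H₁.neg = ∅) (hpos₂ : H₂.neg = ∅)
    (s₁ s₂ t₁ t₂ : V₁) (s₁' s₂' t₁' t₂' : V₂) :
    ∀ M : Matroid (E₁ ⊕ E₂ ⊕ Fin 4),
      (glueWith H₁ H₂ ![(s₁, s₁'), (s₂, s₂'), (t₁, t₁'), (t₂, t₂')]).IsFrameMatroid M ↔
      (glueWith H₁ H₂ ![(s₁, s₂'), (s₂, s₁'), (t₁, t₂'), (t₂, t₁')]).IsFrameMatroid M := by
  intro M
  obtain ⟨r, hr⟩ := SGraph.exists_rep
    (glueWith H₁ H₂ ![(s₁, s₁'), (s₂, s₂'), (t₁, t₁'), (t₂, t₂')])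
  have hr' := SGraph.flip_isRep H₁ H₂ hpos₁ hpos₂ s₁ s₂ t₁ t₂ s₁' s₂' t₁' t₂' hr
  have key : ∀ C, (glueWith H₁ H₂ ![(s₁, s₁'), (s₂, s₂'), (t₁, t₁'), (t₂, t₂')]).FrameCircuit C ↔
      (glueWith H₁ H₂ ![(s₁, s₂'), (s₂, s₁'), (t₁, t₂'), (t₂, t₁')]).FrameCircuit C := by
    intro C
    rw [SGraph.frame_iff hr, SGraph.frame_iff hr']
    exact SGraph.Circ_congr (SGraph.ker_flip s₁' s₂' t₁' t₂' r) C
  unfold SGraph.IsFrameMatroid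
  simp only [key]
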